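/- Let H be a real inner product space and τ > 0. Let u, ū, u', g, g' ∈ H, let r, r', D, Q, N ∈ ℝ with D ≥ 0 and Q ≥ 0, and assume: (i) (1/(2τ))·(‖ū‖² − ‖u‖² + ‖ū − u‖²) + D + ⟪g, ū⟫ = −N; (ii) u' + τ·g' = ū + τ·g and ⟪g', u'⟫ = 0; (iii) (1/τ)·((r')² − r² + (r' − r)²) = N − Q. Then (½·‖u'‖² + (τ²/2)·‖g'‖² + (r')²) − (½·‖u‖² + (τ²/2)·‖g‖² + r²) ≤ −τ·D − τ·Q; more precisely, ½·(‖u'‖² − ‖u‖² + ‖ū − u‖²) + (τ²/2)·(‖g'‖² − ‖g‖²) + (r')² − r² + (r' − r)² + τ·D + τ·Q = 0. -/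

import Mathlib

open RealInnerProductSpace

/-- Algebraic skeleton of the unconditional energy stability of Theorem 2.1:
from the tested momentum equation (i), the projection step (ii), and the
SAV equation multiplied by `2 r'` (iii), the modified discrete energy
`½‖u‖² + (τ²/2)‖g‖² + r²` decays; more precisely one has the exact energy
identity. -/
theorem sav_energy_stability
    {H : Type*} [NormedAddCommGroup H] [InnerProductSpace ℝ H]
    (τ : ℝ) (hτ : 0 < τ)
    (u ubar u' g g' : H) (r r' D Q N : ℝ)
    (hD : 0 ≤ D) (hQ : 0 ≤ Q)
    (hmom : (1 / (2 * τ)) * (‖ubar‖ ^ 2 - ‖u‖ ^ 2 + ‖ubar - u‖ ^ 2) + D + ⟪g, ubar⟫ = -N)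
    (hproj : u' + τ • g' = ubar + τ • g)
    (horth : ⟪g', u'⟫ = 0)
    (hr : (1 / τ) * (r' ^ 2 - r ^ 2 + (r' - r) ^ 2) = N - Q) :
    ((1 / 2) * ‖u'‖ ^ 2 + (τ ^ 2 / 2) * ‖g'‖ ^ 2 + r' ^ 2)
        - ((1 / 2) * ‖u‖ ^ 2 + (τ ^ 2 / 2) * ‖g‖ ^ 2 + r ^ 2)
      ≤ -τ * D - τ * Q
    ∧ (1 / 2) * (‖u'‖ ^ 2 - ‖u‖ ^ 2 + ‖ubar - u‖ ^ 2)
        + (τ ^ 2 / 2) * (‖g'‖ ^ 2 - ‖g‖ ^ 2)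
        + r' ^ 2 - r ^ 2 + (r' - r) ^ 2 + τ * D + τ * Q = 0 := by
  have h1 : ‖u'‖ ^ 2 + τ ^ 2 * ‖g'‖ ^ 2
      = ‖ubar‖ ^ 2 + 2 * τ * ⟪g, ubar⟫ + τ ^ 2 * ‖g‖ ^ 2 := by
    have h := congrArg (fun x : H => ‖x‖ ^ 2) hproj
    simp only [norm_add_sq_real, real_inner_smul_right, norm_smul, mul_pow,
      Real.norm_eq_abs, sq_abs] at h
    rw [real_inner_comm] at horth
    rw [horth, real_inner_comm g ubar] at h
    linarith
  have h2 : (1 / 2) * (‖ubar‖ ^ 2 - ‖u‖ ^ 2 + ‖ubar - u‖ ^ 2) + τ * D + τ * ⟪g, ubar⟫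
      = -(τ * N) := by
    have h := congrArg (fun x : ℝ => τ * x) hmom
    field_simp at h
    linarith
  have h3 : r' ^ 2 - r ^ 2 + (r' - r) ^ 2 = τ * N - τ * Q := by
    have h := congrArg (fun x : ℝ => τ * x) hr
    field_simp at h
    linarith
  have key : (1 / 2) * (‖u'‖ ^ 2 - ‖u‖ ^ 2 + ‖ubar - u‖ ^ 2)
        + (τ ^ 2 / 2) * (‖g'‖ ^ 2 - ‖g‖ ^ 2)
        + r' ^ 2 - r ^ 2 + (r' - r) ^ 2 + τ * D + τ * Q = 0 := by
    linarith
  refine ⟨?_, key⟩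
  have h4 := sq_nonneg ‖ubar - u‖
  have h5 := sq_nonneg (r' - r)
  linarith
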